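/- Let 0 ≤ t < 1 and define g : ℂ → ℂ by g(z) = z² + t z⁴ + (t²/3) z⁶. Then the following are equivalent: (1) for every a ∈ ℂ with |a| = 1, the set {z ∈ ℂ : |z| = 1 and g(z) = g(a)} has exactly two elements (namely a and −a); (2) 0 ≤ t < √3/2. -/

import Mathlib

open Complex

/-- For `|t| < √3/2` the cubic `w + t w² + (t²/3) w³` is injective on the unit circle. -/
lemma cubic_injOn_unit_circle {t : ℝ} (ht : 4 * t ^ 2 < 3) {w u : ℂ}
    (hw : ‖w‖ = 1) (hu : ‖u‖ = 1)
    (h : w + (t : ℂ) * w ^ 2 + ((t : ℂ) ^ 2 / 3) * w ^ 3 =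
      u + (t : ℂ) * u ^ 2 + ((t : ℂ) ^ 2 / 3) * u ^ 3) : w = u := by
  by_contra hne
  have hw' : w * (starRingEnd ℂ) w = 1 := by simp [Complex.mul_conj', hw]
  have hu' : u * (starRingEnd ℂ) u = 1 := by simp [Complex.mul_conj', hu]
  have hE : 3 + 3 * (t : ℂ) * (w + u) + (t : ℂ) ^ 2 * (w ^ 2 + w * u + u ^ 2) = 0 := by
    apply mul_left_cancel₀ (sub_ne_zero.mpr hne)
    linear_combination 3 * h
  have hE' := congrArg (starRingEnd ℂ) hE
  simp only [map_add, map_mul, map_pow, Complex.conj_ofReal, map_ofNat, map_zero] at hE'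
  have hnorm : ‖w + u‖ ≤ 2 := (norm_add_le w u).trans (by rw [hw, hu]; norm_num)
  have hsq : (w + u) * ((starRingEnd ℂ) w + (starRingEnd ℂ) u) = ((‖w + u‖ ^ 2 : ℝ) : ℂ) := by
    rw [← map_add, Complex.mul_conj']; push_cast; rfl
  have hre : w + (starRingEnd ℂ) w = ((2 * w.re : ℝ) : ℂ) := Complex.add_conj w
  generalize (starRingEnd ℂ) w = w' at *
  generalize (starRingEnd ℂ) u = u' at *
  have hw0 : w ≠ 0 := left_ne_zero_of_mul_eq_one hw'
  have hu0 : u ≠ 0 := left_ne_zero_of_mul_eq_one hu'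
  obtain rfl : w' = w⁻¹ := eq_inv_of_mul_eq_one_right hw'
  obtain rfl : u' = u⁻¹ := eq_inv_of_mul_eq_one_right hu'
  field_simp at hE'
  have hfac : (w * u - 1) * (w * u + 1 + t * (w + u)) = 0 := by
    linear_combination (1 / 3 : ℂ) * hE' - (1 / 3 : ℂ) * hE
  rcases mul_eq_zero.mp hfac with hq | hq
  · have hinv : u = w⁻¹ := eq_inv_of_mul_eq_one_right (sub_eq_zero.mp hq)
    have hreal : 3 + 3 * t * (2 * w.re) + t ^ 2 * ((2 * w.re) ^ 2 - 1) = 0 := by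
      rw [← hinv] at hre
      have : (3 : ℂ) + 3 * t * ((2 * w.re : ℝ) : ℂ) +
          t ^ 2 * (((2 * w.re : ℝ) : ℂ) ^ 2 - 1) = 0 := by
        rw [← hre]
        linear_combination hE + (t : ℂ) ^ 2 * hq
      exact_mod_cast this
    nlinarith [sq_nonneg (2 * t * w.re + 3 / 2)]
  · have hquad : (w * u) ^ 2 - (1 + (t : ℂ) ^ 2) * (w * u) + 1 = 0 := by
      linear_combination hE - (2 - w * u + t * (w + u)) * hq
    have hreal : t ^ 2 * ‖w + u‖ ^ 2 = 3 + t ^ 2 := by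
      have : (t : ℂ) ^ 2 * ((‖w + u‖ ^ 2 : ℝ) : ℂ) = 3 + (t : ℂ) ^ 2 := by
        rw [← hsq]
        field_simp
        linear_combination (t * (w + u) - (w * u + 1)) * hq + hquad
      exact_mod_cast this
    nlinarith [norm_nonneg (w + u),
      mul_le_mul_of_nonneg_left (pow_le_pow_left₀ (norm_nonneg _) hnorm 2) (sq_nonneg t)]

/-- For `√3/2 ≤ t < 1` there is a non-real point of the unit circle at which the cubic
`w + t w² + (t²/3) w³` takes the same value as at its conjugate. -/
lemma exists_cubic_eq_conj {t : ℝ} (ht0 : 0 ≤ t) (ht1 : t < 1) (ht : 3 ≤ 4 * t ^ 2) :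
    ∃ w : ℂ, ‖w‖ = 1 ∧ (starRingEnd ℂ) w ≠ w ∧
      w + (t : ℂ) * w ^ 2 + ((t : ℂ) ^ 2 / 3) * w ^ 3 =
        (starRingEnd ℂ) w + (t : ℂ) * (starRingEnd ℂ) w ^ 2 +
          ((t : ℂ) ^ 2 / 3) * (starRingEnd ℂ) w ^ 3 := by
  have htpos : 0 < t := by nlinarith
  obtain ⟨r, hr0, hr⟩ : ∃ r : ℝ, 0 ≤ r ∧ r ^ 2 = 16 * t ^ 2 - 12 :=
    ⟨_, Real.sqrt_nonneg _, Real.sq_sqrt (by linarith)⟩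
  have hr2 : r < 2 := by nlinarith
  obtain ⟨c, hc⟩ : ∃ c : ℝ, 8 * t * c = r - 6 := ⟨(r - 6) / (8 * t), by field_simp⟩
  have hquad : 4 * t ^ 2 * c ^ 2 + 6 * t * c + 3 - t ^ 2 = 0 := by
    linear_combination (1 / 16 : ℝ) * (8 * t * c + r + 6) * hc + (1 / 16 : ℝ) * hr
  have hc1 : c ^ 2 < 1 := by
    have : t ^ 2 * (1 - c ^ 2) > 0 := by nlinarith
    nlinarith [pos_of_mul_pos_right this (sq_nonneg t)]
  obtain ⟨y, hy0, hy⟩ : ∃ y : ℝ, 0 < y ∧ y ^ 2 = 1 - c ^ 2 :=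
    ⟨_, Real.sqrt_pos.mpr (by linarith), Real.sq_sqrt (by linarith)⟩
  have hadd : (⟨c, y⟩ : ℂ) + (starRingEnd ℂ) ⟨c, y⟩ = ((2 * c : ℝ) : ℂ) := Complex.add_conj _
  have hmul := Complex.mul_conj (⟨c, y⟩ : ℂ)
  have hn : Complex.normSq ⟨c, y⟩ = 1 := by
    rw [Complex.normSq_mk]; linarith
  rw [hn] at hmul
  refine ⟨⟨c, y⟩, ?_, ?_, ?_⟩
  · rw [← Complex.sq_norm] at hn
    exact (pow_eq_one_iff_of_nonneg (norm_nonneg _) two_ne_zero).mp hn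
  · intro h
    have := congrArg Complex.im h
    simp at this
    linarith
  · have hquad' : 4 * (t : ℂ) ^ 2 * (c : ℂ) ^ 2 + 6 * t * c + 3 - (t : ℂ) ^ 2 = 0 := by
      exact_mod_cast hquad
    generalize (starRingEnd ℂ) (⟨c, y⟩ : ℂ) = w' at *
    generalize (⟨c, y⟩ : ℂ) = w at *
    push_cast at hadd hmul
    obtain rfl : w' = 2 * c - w := by linear_combination hadd
    linear_combination (2 * w - 2 * c) / 3 * hquad' - (2 * w - 2 * c) / 3 * (t : ℂ) ^ 2 * hmul

/-- for `0 ≤ t < 1` and `g(z) = z² + t z⁴ + (t²/3) z⁶`, every value `g(a)`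
with `|a| = 1` has exactly the two preimages `a, −a` on the unit circle iff
`0 ≤ t < √3/2`. -/
theorem stmt_19 (t : ℝ) (ht0 : 0 ≤ t) (ht1 : t < 1) :
    (∀ a : ℂ, ‖a‖ = 1 →
        {z : ℂ | ‖z‖ = 1 ∧
            z ^ 2 + (t : ℂ) * z ^ 4 + ((t : ℂ) ^ 2 / 3) * z ^ 6 =
              a ^ 2 + (t : ℂ) * a ^ 4 + ((t : ℂ) ^ 2 / 3) * a ^ 6} = {a, -a}) ↔
      0 ≤ t ∧ t < Real.sqrt 3 / 2 := by
  have h3 : Real.sqrt 3 ^ 2 = 3 := Real.sq_sqrt (by norm_num)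
  have h30 : 0 ≤ Real.sqrt 3 := Real.sqrt_nonneg 3
  constructor
  · intro H
    refine ⟨ht0, ?_⟩
    by_contra! hlt
    obtain ⟨w, hw, hne, heq⟩ := exists_cubic_eq_conj ht0 ht1 (by nlinarith)
    obtain ⟨z, rfl⟩ := IsAlgClosed.exists_pow_nat_eq w two_pos
    have hz : ‖z‖ = 1 := by
      rw [norm_pow] at hw
      exact (pow_eq_one_iff_of_nonneg (norm_nonneg z) two_ne_zero).mp hw
    have hmem : (starRingEnd ℂ) z ∈ ({z, -z} : Set ℂ) := by
      rw [← H z hz]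
      refine ⟨by rw [Complex.norm_conj, hz], ?_⟩
      rw [map_pow] at heq
      linear_combination -heq
    apply hne
    rw [map_pow]
    rcases hmem with h | h
    · rw [h]
    · rw [Set.mem_singleton_iff.mp h, neg_sq]
  · rintro ⟨-, hlt⟩ a ha
    ext z
    simp only [Set.mem_ofPred_eq, Set.mem_insert_iff, Set.mem_singleton_iff]
    constructor
    · rintro ⟨hz, h⟩
      apply sq_eq_sq_iff_eq_or_eq_neg.mp
      apply cubic_injOn_unit_circle (t := t) (by nlinarith) (by simp [hz]) (by simp [ha])
      linear_combination h
    · rintro (rfl | rfl)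
      · exact ⟨ha, rfl⟩
      · exact ⟨by rw [norm_neg, ha], by ring⟩
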